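/- arXiv:2605.25608 — 2 statements merged into one kernel-verified Lean document; each statement's English description precedes it below -/
import Mathlib

section
/- For every d ≥ 2 and every k ∈ ℕ with k ≥ 1, setting s = ⌈log₂ d⌉, there exists a function φ ∈ NN(6dk, 2s, K) with K ≤ 722^s · 2^{(7s² − 7s)/4} such that φ : [−1,1]^d → [−1,1], φ(x) = 0 whenever some coordinate x_i = 0, and |x_1 ⋯ x_d − φ(x)| ≤ 6d/k² for all x = (x_1, …, x_d) ∈ [−1,1]^d. -/
open scoped BigOperators

noncomputable section

/-- ReLU activation. -/
def relu (t : ℝ) : ℝ := max 0 t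

/-- Squared Frobenius norm of a matrix. -/
def frobSq {m n : ℕ} (A : Matrix (Fin m) (Fin n) ℝ) : ℝ := ∑ i, ∑ j, (A i j) ^ 2

/-- Frobenius norm of a matrix. -/
def frob {m n : ℕ} (A : Matrix (Fin m) (Fin n) ℝ) : ℝ := Real.sqrt (frobSq A)

/-- Squared Euclidean norm of a vector. -/
def sqNorm {n : ℕ} (v : Fin n → ℝ) : ℝ := ∑ i, (v i) ^ 2

/-- A ReLU network of depth `D`, input dimension `d` and output dimension `k`:
layer widths `N 0 = d, N 1, …, N D, N (D+1) = k`, weight matrices `A ℓ` and biases `b ℓ`. -/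
structure ReluNetwork (D d k : ℕ) where
  N : ℕ → ℕ
  hN0 : N 0 = d
  hNlast : N (D + 1) = k
  A : (ℓ : ℕ) → Matrix (Fin (N (ℓ + 1))) (Fin (N ℓ)) ℝ
  b : (ℓ : ℕ) → Fin (N (ℓ + 1)) → ℝ

namespace ReluNetwork

variable {D d k : ℕ}

/-- Output of the `ℓ`-th hidden layer (after the ReLU). -/
def layer (net : ReluNetwork D d k) : (ℓ : ℕ) → (Fin d → ℝ) → Fin (net.N ℓ) → ℝ
  | 0 => fun x i => x (Fin.cast net.hN0 i)
  | (ℓ + 1) => fun x i =>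
      relu ((∑ j, net.A ℓ i j * net.layer ℓ x j) + net.b ℓ i)

/-- The function realized by the network:
`f_θ(x) = A_D σ(A_{D-1} σ( ⋯ σ(A_0 x + b_0) ⋯ ) + b_{D-1})`. -/
def realize (net : ReluNetwork D d k) (x : Fin d → ℝ) : Fin k → ℝ :=
  fun i => ∑ j, net.A D (Fin.cast net.hNlast.symm i) j * net.layer D x j

/-- Multiplicative Frobenius norm constraint
`κ(θ) = ‖A_D‖_F ∏_{ℓ<D} √(‖A_ℓ‖_F² + ‖b_ℓ‖² + 1)`. -/
def kappa (net : ReluNetwork D d k) : ℝ :=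
  frob (net.A D) *
    ∏ ℓ ∈ Finset.range D, Real.sqrt (frobSq (net.A ℓ) + sqNorm (net.b ℓ) + 1)

/-- All (hidden) layer widths are at most `W`. -/
def widthLe (net : ReluNetwork D d k) (W : ℕ) : Prop :=
  ∀ ℓ, 0 < ℓ → ℓ ≤ D → net.N ℓ ≤ W

end ReluNetwork

/-- The norm-constrained class `NN(W, D, K)` of functions `ℝ^d → ℝ^k` realized by depth-`D`
ReLU networks with all layer widths at most `W` and `κ(θ) ≤ K`. -/
def NNclass (d k W D : ℕ) (K : ℝ) : Set ((Fin d → ℝ) → Fin k → ℝ) :=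
  {f | ∃ net : ReluNetwork D d k, net.widthLe W ∧ net.kappa ≤ K ∧ net.realize = f}

/-- The cube `[a,b]^n` in `ℝ^n`. -/
def cube (n : ℕ) (a b : ℝ) : Set (Fin n → ℝ) := {x | ∀ i, x i ∈ Set.Icc a b}

open Finset

/-- Layers of a network with weights indexed by natural numbers. -/
def Lay (N : ℕ → ℕ) (a : ℕ → ℕ → ℕ → ℝ) (b : ℕ → ℕ → ℝ) (X : ℕ → ℝ) : ℕ → ℕ → ℝ
  | 0, i => X i
  | (l + 1), i => relu ((∑ j ∈ range (N l), a l i j * Lay N a b X l j) + b l i)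

/-- Squared norm of layer `l`, plus one. -/
def lnorm (N : ℕ → ℕ) (a : ℕ → ℕ → ℕ → ℝ) (b : ℕ → ℕ → ℝ) (l : ℕ) : ℝ :=
  (∑ i ∈ range (N (l + 1)), ∑ j ∈ range (N l), (a l i j) ^ 2)
    + (∑ i ∈ range (N (l + 1)), (b l i) ^ 2) + 1

/-- Extension of the input by ones. -/
def padOne {d : ℕ} (x : Fin d → ℝ) (i : ℕ) : ℝ := if h : i < d then x ⟨i, h⟩ else 1

/-- `f` is the output of the `D`-th hidden layer of a network. -/
def Rlz (d W D : ℕ) {ι : Type} [Fintype ι] (f : (Fin d → ℝ) → ι → ℝ) (Q : ℝ) : Prop :=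
  ∃ (N : ℕ → ℕ) (a : ℕ → ℕ → ℕ → ℝ) (b : ℕ → ℕ → ℝ) (e : ι ≃ Fin (N D)),
    N 0 = d ∧ (∀ l, 0 < l → l ≤ D → N l ≤ W) ∧ (∏ l ∈ range D, lnorm N a b l) ≤ Q ∧
    ∀ x i, f x i = Lay N a b (padOne x) D (e i)

lemma Lay_congr {N N' : ℕ → ℕ} {a a' : ℕ → ℕ → ℕ → ℝ} {b b' : ℕ → ℕ → ℝ} (X : ℕ → ℝ) (D : ℕ)
    (hN : ∀ l ≤ D, N' l = N l) (ha : ∀ l < D, a' l = a l) (hb : ∀ l < D, b' l = b l) :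
    Lay N' a' b' X D = Lay N a b X D := by
  induction D with
  | zero => funext i; simp [Lay]
  | succ D ih =>
    have h := ih (fun l hl => hN l (by omega)) (fun l hl => ha l (by omega))
      (fun l hl => hb l (by omega))
    funext i
    simp only [Lay]
    rw [h, hN D (by omega), ha D (by omega), hb D (by omega)]

lemma lnorm_pos (N : ℕ → ℕ) (a : ℕ → ℕ → ℕ → ℝ) (b : ℕ → ℕ → ℝ) (l : ℕ) :
    0 < lnorm N a b l := by
  unfold lnorm; positivity

lemma extend {ι κ : Type} [Fintype ι] [Fintype κ] (N : ℕ → ℕ) (a : ℕ → ℕ → ℕ → ℝ)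
    (b : ℕ → ℕ → ℝ) (D : ℕ) (e : ι ≃ Fin (N D)) (A : κ → ι → ℝ) (β : κ → ℝ) :
    ∃ (N' : ℕ → ℕ) (a' : ℕ → ℕ → ℕ → ℝ) (b' : ℕ → ℕ → ℝ) (e' : κ ≃ Fin (N' (D + 1))),
      N' (D + 1) = Fintype.card κ ∧ (∀ l ≤ D, N' l = N l) ∧ (∀ l < D, a' l = a l) ∧
      (∀ l < D, b' l = b l) ∧
      (∀ (g : ℕ → ℝ) (i : κ), (∑ j ∈ range (N' D), a' D (e' i) j * g j)
        = ∑ j, A i j * g (e j)) ∧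
      (∀ i : κ, b' D (e' i) = β i) ∧
      lnorm N' a' b' D = (∑ i, ∑ j, A i j ^ 2) + (∑ i, β i ^ 2) + 1 := by
  classical
  let E := Fintype.equivFin κ
  let N' : ℕ → ℕ := fun l => if l ≤ D then N l else Fintype.card κ
  have h1 : N' (D + 1) = Fintype.card κ := by simp [N']
  have h0 : N' D = N D := by simp [N']
  let a' : ℕ → ℕ → ℕ → ℝ := fun l i j => if l < D then a l i j else
    if h : i < Fintype.card κ ∧ j < N D then A (E.symm ⟨i, h.1⟩) (e.symm ⟨j, h.2⟩) else 0
  let b' : ℕ → ℕ → ℝ := fun l i => if l < D then b l i else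
    if h : i < Fintype.card κ then β (E.symm ⟨i, h⟩) else 0
  have ha : ∀ (i : Fin (Fintype.card κ)) (j : Fin (N D)),
      a' D i j = A (E.symm i) (e.symm j) := by
    intro i j
    have hi := i.2
    have hj := j.2
    simp [a']
  have hb : ∀ (i : Fin (Fintype.card κ)), b' D i = β (E.symm i) := by
    intro i
    have hi := i.2
    simp [b']
  refine ⟨N', a', b', E.trans (finCongr h1.symm), h1, ?_, ?_, ?_, ?_, ?_, ?_⟩
  · intro l hl; simp [N', hl]
  · intro l hl; funext i j; simp [a', hl]
  · intro l hl; funext i; simp [b', hl]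
  · intro g i
    rw [h0, ← Fin.sum_univ_eq_sum_range (fun j => a' D _ j * g j)]
    rw [← e.sum_comp]
    refine Finset.sum_congr rfl fun j _ => ?_
    have := ha (E i) (e j)
    simp only [Equiv.symm_apply_apply] at this
    rw [← this]; simp
  · intro i
    have := hb (E i)
    simp only [Equiv.symm_apply_apply] at this
    rw [← this]; simp
  · unfold lnorm
    rw [h0, h1]
    congr 2
    · rw [← Fin.sum_univ_eq_sum_range (fun i => ∑ j ∈ range (N D), a' D i j ^ 2), ← E.sum_comp]
      refine Finset.sum_congr rfl fun i _ => ?_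
      rw [← Fin.sum_univ_eq_sum_range (fun j => a' D _ j ^ 2), ← e.sum_comp]
      refine Finset.sum_congr rfl fun j _ => ?_
      rw [ha]; simp
    · rw [← Fin.sum_univ_eq_sum_range (fun i => b' D i ^ 2), ← E.sum_comp]
      refine Finset.sum_congr rfl fun i _ => ?_
      rw [hb]; simp

lemma prod_lnorm_congr {N N' : ℕ → ℕ} {a a' : ℕ → ℕ → ℕ → ℝ} {b b' : ℕ → ℕ → ℝ} (D : ℕ)
    (hN : ∀ l ≤ D, N' l = N l) (ha : ∀ l < D, a' l = a l) (hb : ∀ l < D, b' l = b l) :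
    (∏ l ∈ range D, lnorm N' a' b' l) = ∏ l ∈ range D, lnorm N a b l := by
  refine Finset.prod_congr rfl fun l hl => ?_
  have hl := Finset.mem_range.1 hl
  unfold lnorm
  rw [hN l hl.le, hN (l + 1) hl, ha l hl, hb l hl]

lemma Rlz.step {d W D : ℕ} {ι κ : Type} [Fintype ι] [Fintype κ] {f : (Fin d → ℝ) → ι → ℝ}
    {Q : ℝ} (h : Rlz d W D f Q) (A : κ → ι → ℝ) (β : κ → ℝ) (hW : Fintype.card κ ≤ W) (q : ℝ)
    (hq : (∑ i, ∑ j, A i j ^ 2) + (∑ i, β i ^ 2) + 1 ≤ q) :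
    Rlz d W (D + 1) (fun x i => relu ((∑ j, A i j * f x j) + β i)) (Q * q) := by
  obtain ⟨N, a, b, e, hN0, hNW, hQ, hf⟩ := h
  obtain ⟨N', a', b', e', h1, hN, ha, hb, hA, hβ, hn⟩ := extend N a b D e A β
  refine ⟨N', a', b', e', ?_, ?_, ?_, ?_⟩
  · rw [hN 0 (by omega), hN0]
  · intro l hl hl'
    rcases Nat.lt_or_ge D l with h | h
    · have : l = D + 1 := by omega
      subst this; rw [h1]; exact hW
    · rw [hN l h]; exact hNW l hl h
  · rw [Finset.prod_range_succ, prod_lnorm_congr D hN ha hb]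
    have hpos : 0 ≤ ∏ l ∈ range D, lnorm N a b l :=
      Finset.prod_nonneg fun l _ => (lnorm_pos N a b l).le
    exact mul_le_mul hQ (hn ▸ hq) (lnorm_pos _ _ _ _).le (hpos.trans hQ)
  · intro x i
    simp only [Lay]
    rw [hA, hβ, Lay_congr _ D hN ha hb]
    simp only [hf]

lemma Rlz.final {d W D : ℕ} {ι : Type} [Fintype ι] {f : (Fin d → ℝ) → ι → ℝ}
    {Q : ℝ} (h : Rlz d W D f Q) (c : ι → ℝ) (q : ℝ) (hq : (∑ j, c j ^ 2) ≤ q)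
    (K : ℝ) (hK : 0 ≤ K) (hKQ : q * Q ≤ K ^ 2) :
    (fun x _ => ∑ j, c j * f x j) ∈ NNclass d 1 W D K := by
  obtain ⟨N, a, b, e, hN0, hNW, hQ, hf⟩ := h
  obtain ⟨N', a', b', e', h1, hN, ha, hb, hA, hβ, hn⟩ :=
    extend N a b D e (fun (_ : Fin 1) j => c j) (fun _ => 0)
  have h1' : N' (D + 1) = 1 := by simpa using h1
  let net : ReluNetwork D d 1 :=
    { N := N', hN0 := by rw [hN 0 (by omega), hN0], hNlast := h1',
      A := fun l i j => a' l i j, b := fun l i => b' l i }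
  have hlay : ∀ (x : Fin d → ℝ) (l : ℕ) (i : Fin (N' l)),
      net.layer l x i = Lay N' a' b' (padOne x) l i := by
    intro x l
    induction l with
    | zero =>
      intro i
      have : (i : ℕ) < d := by have := i.2; have := net.hN0; simp only [net] at this; omega
      simp only [ReluNetwork.layer, Lay, padOne, this, dite_true]
      rfl
    | succ l ih =>
      intro i
      simp only [ReluNetwork.layer, Lay]
      congr 2
      rw [← Fin.sum_univ_eq_sum_range (fun j => a' l i j * Lay N' a' b' (padOne x) l j)]
      exact Finset.sum_congr rfl fun j _ => by rw [ih]
  have hln : ∀ l, frobSq (net.A l) + sqNorm (net.b l) + 1 = lnorm N' a' b' l := by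
    intro l
    unfold frobSq sqNorm lnorm
    congr 2
    · rw [← Fin.sum_univ_eq_sum_range (fun i => ∑ j ∈ range (N' l), a' l i j ^ 2)]
      refine Finset.sum_congr rfl fun i _ => ?_
      rw [← Fin.sum_univ_eq_sum_range (fun j => a' l _ j ^ 2)]
    · rw [← Fin.sum_univ_eq_sum_range (fun i => b' l i ^ 2)]
  refine ⟨net, ?_, ?_, ?_⟩
  · intro l hl hl'
    show N' l ≤ W
    rw [hN l hl']; exact hNW l hl hl'
  · unfold ReluNetwork.kappa frob
    simp only [hln]
    have hfr : frobSq (net.A D) ≤ q := by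
      have h2 := hln D
      rw [hn] at h2
      have h3 : 0 ≤ sqNorm (net.b D) := by unfold sqNorm; positivity
      simp at h2
      linarith
    have hfr0 : 0 ≤ frobSq (net.A D) := by unfold frobSq; positivity
    have hpos : 0 ≤ ∏ l ∈ range D, lnorm N' a' b' l :=
      Finset.prod_nonneg fun l _ => (lnorm_pos N' a' b' l).le
    have hprod : (∏ l ∈ range D, Real.sqrt (lnorm N' a' b' l))
        = Real.sqrt (∏ l ∈ range D, lnorm N' a' b' l) := by
      rw [Real.sqrt_prod]
      exact fun l _ => (lnorm_pos N' a' b' l).le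
    rw [hprod, ← Real.sqrt_mul hfr0]
    apply Real.sqrt_le_iff.2 ⟨hK, ?_⟩
    refine le_trans ?_ hKQ
    refine mul_le_mul hfr ?_ hpos (hfr0.trans hfr)
    rw [prod_lnorm_congr D hN ha hb]; exact hQ
  · funext x i
    unfold ReluNetwork.realize
    simp only [hlay]
    have := hA (Lay N a b (padOne x) D) 0
    simp only [hf]
    rw [← this, ← Fin.sum_univ_eq_sum_range
      (fun j => a' D (e' 0) j * Lay N a b (padOne x) D j), Lay_congr _ D hN ha hb]
    refine Finset.sum_congr rfl fun j _ => ?_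
    congr 1
    show a' D _ _ = a' D _ _
    congr 1
    have hh := (e' 0).2
    have hi := (Fin.cast h1'.symm i).2
    omega

/-- Piecewise linear approximation of the square on `[0,1]`. -/
def gsq (k : ℕ) (u : ℝ) : ℝ := 2 / k * ∑ j : Fin k, relu (u - (j + 1 / 2) / k)

/-- Approximate product. -/
def aprod (k : ℕ) (x y : ℝ) : ℝ := gsq k (|x + y| / 2) - gsq k (|x - y| / 2)

lemma gsq_aux1 (h : ℝ) (hh : 0 < h) (m : ℕ) (u : ℝ) (hu : m * h ≤ u) :
    2 * h * ∑ j ∈ range m, relu (u - (j + 1 / 2) * h) = 2 * h * m * u - h ^ 2 * m ^ 2 := by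
  induction m with
  | zero => simp
  | succ m ih =>
    push_cast at hu
    rw [Finset.sum_range_succ, mul_add, ih (by nlinarith)]
    have : relu (u - (m + 1 / 2) * h) = u - (m + 1 / 2) * h := by
      unfold relu; apply max_eq_right; nlinarith
    rw [this]; push_cast; ring

lemma gsq_aux2 (h : ℝ) (hh : 0 < h) (m : ℕ) (u : ℝ) (hu0 : 0 ≤ u) (hu : u ≤ m * h) :
    u ^ 2 - h ^ 2 / 4 ≤ 2 * h * ∑ j ∈ range m, relu (u - (j + 1 / 2) * h) ∧
    2 * h * ∑ j ∈ range m, relu (u - (j + 1 / 2) * h) ≤ u ^ 2 := by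
  induction m with
  | zero =>
    have : u = 0 := by simp at hu; linarith
    subst this; simp; positivity
  | succ m ih =>
    push_cast at hu
    rw [Finset.sum_range_succ, mul_add]
    rcases le_total u (m * h) with h1 | h1
    · have : relu (u - (m + 1 / 2) * h) = 0 := by
        unfold relu; apply max_eq_left; nlinarith
      rw [this]; simpa using ih h1
    · rw [gsq_aux1 h hh m u h1]
      obtain ⟨r, rfl⟩ : ∃ r, u = m * h + r := ⟨u - m * h, by ring⟩
      have hr0 : 0 ≤ r := by linarith
      have hr1 : r ≤ h := by linarith
      unfold relu
      rcases le_total r (h / 2) with h2 | h2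
      · rw [max_eq_left (by linarith)]
        constructor <;> nlinarith
      · rw [max_eq_right (by linarith)]
        constructor <;> nlinarith

lemma gsq_bound (k : ℕ) (hk : 1 ≤ k) (u : ℝ) (hu0 : 0 ≤ u) (hu : u ≤ 1) :
    u ^ 2 - 1 / (k : ℝ) ^ 2 ≤ gsq k u ∧ gsq k u ≤ u ^ 2 ∧ 0 ≤ gsq k u := by
  have hk' : (0 : ℝ) < k := by exact_mod_cast hk
  have h := gsq_aux2 (1 / k) (by positivity) k u hu0 (by field_simp; exact hu)
  have e : gsq k u = 2 * (1 / k) * ∑ j ∈ range k, relu (u - (j + 1 / 2) * (1 / k)) := by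
    unfold gsq
    rw [Fin.sum_univ_eq_sum_range (fun j : ℕ => relu (u - ((j : ℝ) + 1 / 2) / k))]
    congr 1
    · ring
    · exact Finset.sum_congr rfl fun j _ => by congr 1; ring
  rw [← e] at h
  refine ⟨?_, h.2, ?_⟩
  · have h3 : (0 : ℝ) ≤ 1 / (k : ℝ) ^ 2 := by positivity
    have h4 : (1 / (k : ℝ)) ^ 2 = 1 / (k : ℝ) ^ 2 := by ring
    rw [h4] at h
    linarith [h.1]
  · unfold gsq
    have : 0 ≤ ∑ j : Fin k, relu (u - ((j : ℝ) + 1 / 2) / k) :=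
      Finset.sum_nonneg fun j _ => le_max_left _ _
    positivity

lemma aprod_spec (k : ℕ) (hk : 1 ≤ k) (x y : ℝ) (hx : |x| ≤ 1) (hy : |y| ≤ 1) :
    |aprod k x y| ≤ 1 ∧ |x * y - aprod k x y| ≤ 1 / (k : ℝ) ^ 2 := by
  have hp : |x + y| ≤ 2 := (abs_add_le x y).trans (by linarith)
  have hm : |x - y| ≤ 2 := (abs_sub x y).trans (by linarith)
  have h1 := gsq_bound k hk (|x + y| / 2) (by positivity) (by linarith)
  have h2 := gsq_bound k hk (|x - y| / 2) (by positivity) (by linarith)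
  have e1 : (|x + y| / 2) ^ 2 = (x + y) ^ 2 / 4 := by rw [div_pow, sq_abs]; ring
  have e2 : (|x - y| / 2) ^ 2 = (x - y) ^ 2 / 4 := by rw [div_pow, sq_abs]; ring
  have b1 : (|x + y| / 2) ^ 2 ≤ 1 := by apply pow_le_one₀ <;> first | positivity | linarith
  have b2 : (|x - y| / 2) ^ 2 ≤ 1 := by apply pow_le_one₀ <;> first | positivity | linarith
  unfold aprod
  constructor
  · rw [abs_le]; constructor <;> linarith [h1.1, h1.2.1, h1.2.2, h2.1, h2.2.1, h2.2.2]
  · rw [e1] at h1; rw [e2] at h2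
    rw [abs_le]; constructor <;> nlinarith [h1.1, h1.2.1, h1.2.2, h2.1, h2.2.1, h2.2.2]

lemma aprod_zero_left (k : ℕ) (y : ℝ) : aprod k 0 y = 0 := by simp [aprod]
lemma aprod_zero_right (k : ℕ) (x : ℝ) : aprod k x 0 = 0 := by simp [aprod]

/-- The product tree. -/
def tree (k : ℕ) (X : ℕ → ℝ) : ℕ → ℕ → ℝ
  | 0, p => X p
  | (t + 1), p => aprod k (tree k X t (2 * p)) (tree k X t (2 * p + 1))

lemma tree_abs (k : ℕ) (hk : 1 ≤ k) (X : ℕ → ℝ) (hX : ∀ i, |X i| ≤ 1) (t p : ℕ) :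
    |tree k X t p| ≤ 1 := by
  induction t generalizing p with
  | zero => exact hX p
  | succ t ih => exact (aprod_spec k hk _ _ (ih _) (ih _)).1

lemma tree_zero (k : ℕ) (X : ℕ → ℝ) (i : ℕ) (hi : X i = 0) (t : ℕ) :
    tree k X t (i / 2 ^ t) = 0 := by
  induction t with
  | zero => simpa [tree] using hi
  | succ t ih =>
    have e : i / 2 ^ (t + 1) = i / 2 ^ t / 2 := by rw [pow_succ, Nat.div_div_eq_div_mul]
    rw [e]
    simp only [tree]
    rcases Nat.mod_two_eq_zero_or_one (i / 2 ^ t) with h | h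
    · rw [show 2 * (i / 2 ^ t / 2) = i / 2 ^ t by omega, ih, aprod_zero_left]
    · rw [show 2 * (i / 2 ^ t / 2) + 1 = i / 2 ^ t by omega, ih, aprod_zero_right]

lemma tree_err (k : ℕ) (hk : 1 ≤ k) (X : ℕ → ℝ) (hX : ∀ i, |X i| ≤ 1) (t p : ℕ) :
    |(∏ q ∈ range (2 ^ t), X (2 ^ t * p + q)) - tree k X t p|
      ≤ ((2 : ℝ) ^ t - 1) * (1 / (k : ℝ) ^ 2) := by
  induction t generalizing p with
  | zero => simp [tree]
  | succ t ih =>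
    have hpr : ∀ p, |∏ q ∈ range (2 ^ t), X (2 ^ t * p + q)| ≤ 1 := by
      intro p
      rw [Finset.abs_prod]
      exact Finset.prod_le_one (fun _ _ => abs_nonneg _) fun _ _ => hX _
    have e : (∏ q ∈ range (2 ^ (t + 1)), X (2 ^ (t + 1) * p + q))
        = (∏ q ∈ range (2 ^ t), X (2 ^ t * (2 * p) + q)) *
          ∏ q ∈ range (2 ^ t), X (2 ^ t * (2 * p + 1) + q) := by
      rw [show 2 ^ (t + 1) = 2 ^ t + 2 ^ t by ring, Finset.prod_range_add]
      congr 1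
      · exact Finset.prod_congr rfl fun q _ => by congr 1; ring
      · exact Finset.prod_congr rfl fun q _ => by congr 1; ring
    rw [e]
    simp only [tree]
    have i1 := ih (2 * p)
    have i2 := ih (2 * p + 1)
    have p1 := hpr (2 * p)
    have t1 := tree_abs k hk X hX t (2 * p)
    have t2 := tree_abs k hk X hX t (2 * p + 1)
    have hs := (aprod_spec k hk _ _ t1 t2).2
    generalize (∏ q ∈ range (2 ^ t), X (2 ^ t * (2 * p) + q)) = a at *
    generalize (∏ q ∈ range (2 ^ t), X (2 ^ t * (2 * p + 1) + q)) = b at *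
    generalize tree k X t (2 * p) = u at *
    generalize tree k X t (2 * p + 1) = v at *
    have e2 : a * b - aprod k u v = a * (b - v) + (a - u) * v + (u * v - aprod k u v) := by ring
    have m1 : |a * (b - v)| ≤ |b - v| := by
      rw [abs_mul]; exact mul_le_of_le_one_left (abs_nonneg _) p1
    have m2 : |(a - u) * v| ≤ |a - u| := by
      rw [abs_mul]; exact mul_le_of_le_one_right (abs_nonneg _) t2
    rw [e2]
    have := abs_add_three (a * (b - v)) ((a - u) * v) (u * v - aprod k u v)
    rw [pow_succ]
    linarith

/-- The values `v x p`, `p < n`, are affine read-outs of a hidden layer. -/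
def Lev (d W D n : ℕ) (v : (Fin d → ℝ) → ℕ → ℝ) (Q : ℝ) (bias : Prop) : Prop :=
  ∃ (ι : Type) (_ : Fintype ι) (f : (Fin d → ℝ) → ι → ℝ) (c : ℕ → ι → ℝ) (β : ℕ → ℝ),
    Rlz d W D f Q ∧ (∀ x, ∀ p < n, v x p = (∑ i, c p i * f x i) + β p) ∧
    (∀ p, (∑ i, c p i ^ 2) + β p ^ 2 ≤ 8) ∧ (¬ bias → ∀ p, β p = 0)

lemma Lev.base (d W n : ℕ) : Lev d W 0 n (fun x => padOne x) 1 True := by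
  refine ⟨Fin d, inferInstance, fun x => x, fun p i => if p = i then 1 else 0,
    fun p => if p < d then 0 else 1, ?_, ?_, ?_, by simp⟩
  · refine ⟨fun _ => d, fun _ _ _ => 0, fun _ _ => 0, Equiv.refl _, rfl, by simp; omega,
      by simp, ?_⟩
    intro x i
    simp [Lay, padOne]
  · intro x p _
    by_cases h : p < d
    · have : ∀ i : Fin d, (p = (i : ℕ)) ↔ (⟨p, h⟩ : Fin d) = i := by
        intro i; rw [Fin.ext_iff]
      simp [padOne, h, this]
    · have : ∀ i : Fin d, ¬ (p = (i : ℕ)) := by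
        intro i; have := i.2; omega
      simp [padOne, h, this]
  · intro p
    by_cases h : p < d
    · have : ∀ i : Fin d, (p = (i : ℕ)) ↔ (⟨p, h⟩ : Fin d) = i := by
        intro i; rw [Fin.ext_iff]
      simp [h, this]
    · have : ∀ i : Fin d, ¬ (p = (i : ℕ)) := by
        intro i; have := i.2; omega
      simp [h, this]

/-- Sign attached to a Boolean. -/
def sg (s : Bool) : ℝ := if s then 1 else -1

lemma sg_sq (s : Bool) : sg s ^ 2 = 1 := by cases s <;> simp [sg]

lemma relu_add_neg (t : ℝ) : relu (1 * t) + relu (-1 * t) = |t| := by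
  unfold relu
  rcases le_total 0 t with h | h
  · rw [abs_of_nonneg h, max_eq_right (by linarith), max_eq_left (by linarith)]; ring
  · rw [abs_of_nonpos h, max_eq_left (by linarith), max_eq_right (by linarith)]; ring

lemma relu_mul (c t : ℝ) (hc : 0 ≤ c) : relu (c * t) = c * relu t := by
  unfold relu
  rw [mul_max_of_nonneg _ _ hc, mul_zero]

lemma Lev.step {d W D n k : ℕ} (hk : 1 ≤ k) {v : (Fin d → ℝ) → ℕ → ℝ} {Q : ℝ} {bias : Prop}
    (h : Lev d W D (2 * n) v Q bias) (M : ℕ) (hM : 1 ≤ M) (hn : n ≤ M) (hA : 4 * n ≤ W)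
    (hB : 2 * k * n ≤ W) :
    Lev d W (D + 2) n (fun x p => aprod k (v x (2 * p)) (v x (2 * p + 1)))
      (Q * (231 * (M : ℝ) ^ 2)) False := by
  obtain ⟨ι, _, f, c, β, hR, hv, hc, -⟩ := h
  have hk' : (0 : ℝ) < k := by exact_mod_cast hk
  have hM' : (1 : ℝ) ≤ M := by exact_mod_cast hM
  have hn' : (n : ℝ) ≤ M := by exact_mod_cast hn
  have hsk : (0 : ℝ) < Real.sqrt k := Real.sqrt_pos.2 hk'
  have hss : Real.sqrt k ^ 2 = k := Real.sq_sqrt hk'.le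
  have h1 := hR.step (κ := Fin n × Bool × Bool)
    (fun r i => sg r.2.2 * (1 / 2 * (c (2 * r.1) i + sg r.2.1 * c (2 * r.1 + 1) i)))
    (fun r => sg r.2.2 * (1 / 2 * (β (2 * r.1) + sg r.2.1 * β (2 * r.1 + 1))))
    (by simp; omega) (33 * M) (by
      rw [← Finset.sum_add_distrib]
      have : ∀ r : Fin n × Bool × Bool,
        (∑ i, (sg r.2.2 * (1 / 2 * (c (2 * r.1) i + sg r.2.1 * c (2 * r.1 + 1) i))) ^ 2)
        + (sg r.2.2 * (1 / 2 * (β (2 * r.1) + sg r.2.1 * β (2 * r.1 + 1)))) ^ 2 ≤ 8 := by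
        intro r
        have key : ∀ s s' : Bool, ∀ a b : ℝ,
            (sg s * (1 / 2 * (a + sg s' * b))) ^ 2 ≤ 1 / 2 * (a ^ 2 + b ^ 2) := by
          intro s s' a b
          rw [mul_pow, sg_sq]
          have := sg_sq s'
          nlinarith [sq_nonneg (a - sg s' * b)]
        have h1 := hc (2 * r.1)
        have h2 := hc (2 * r.1 + 1)
        have h3 : (∑ i, (sg r.2.2 * (1 / 2 * (c (2 * r.1) i + sg r.2.1 * c (2 * r.1 + 1) i))) ^ 2)
            ≤ 1 / 2 * ((∑ i, c (2 * r.1) i ^ 2) + ∑ i, c (2 * r.1 + 1) i ^ 2) := by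
          rw [← Finset.sum_add_distrib, Finset.mul_sum]
          exact Finset.sum_le_sum fun i _ => key _ _ _ _
        have h4 := key r.2.2 r.2.1 (β (2 * r.1)) (β (2 * r.1 + 1))
        linarith
      have h5 := Finset.sum_le_sum fun r (_ : r ∈ Finset.univ) => this r
      simp only [Finset.sum_const, Finset.card_univ, Fintype.card_prod, Fintype.card_fin,
        Fintype.card_bool, nsmul_eq_mul] at h5
      push_cast at h5
      linarith)
  have h2 := h1.step (κ := Fin n × Bool × Fin k)
    (fun r r' => if r'.1 = r.1 ∧ r'.2.1 = r.2.1 then 1 / Real.sqrt k else 0)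
    (fun r => - (1 / Real.sqrt k * (((r.2.2 : ℕ) + 1 / 2) / k)))
    (by simp; calc n * (2 * k) = 2 * k * n := by ring
          _ ≤ W := hB) (7 * M) (by
      rw [← Finset.sum_add_distrib]
      have : ∀ r : Fin n × Bool × Fin k,
        (∑ r' : Fin n × Bool × Bool,
          (if r'.1 = r.1 ∧ r'.2.1 = r.2.1 then 1 / Real.sqrt k else 0) ^ 2)
        + (- (1 / Real.sqrt k * (((r.2.2 : ℕ) + 1 / 2) / k))) ^ 2 ≤ 3 / k := by
        intro r
        have e1 : (∑ r' : Fin n × Bool × Bool,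
          (if r'.1 = r.1 ∧ r'.2.1 = r.2.1 then 1 / Real.sqrt k else 0) ^ 2) = 2 / k := by
          simp only [ite_pow, Fintype.sum_prod_type, ite_and, div_pow, hss]
          simp [Finset.sum_ite_eq']
          ring
        rw [e1, neg_sq, mul_pow, div_pow, hss]
        have : (((r.2.2 : ℕ) + 1 / 2 : ℝ) / k) ≤ 1 := by
          rw [div_le_one hk']
          have : (r.2.2 : ℕ) + 1 ≤ k := r.2.2.2
          have : ((r.2.2 : ℕ) + 1 : ℝ) ≤ k := by exact_mod_cast this
          linarith
        have h2 : (((r.2.2 : ℕ) + 1 / 2 : ℝ) / k) ^ 2 ≤ 1 :=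
          pow_le_one₀ (by positivity) this
        have h3 : 1 ^ 2 / (k : ℝ) * (((r.2.2 : ℕ) + 1 / 2 : ℝ) / k) ^ 2 ≤ 1 ^ 2 / (k : ℝ) * 1 :=
          mul_le_mul_of_nonneg_left h2 (by positivity)
        calc _ ≤ 2 / (k : ℝ) + 1 ^ 2 / (k : ℝ) * 1 := by linarith
          _ = 3 / k := by ring
      have h5 := Finset.sum_le_sum fun r (_ : r ∈ Finset.univ) => this r
      simp only [Finset.sum_const, Finset.card_univ, Fintype.card_prod, Fintype.card_fin,
        Fintype.card_bool, nsmul_eq_mul] at h5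
      push_cast at h5
      have e : (n : ℝ) * (2 * k) * (3 / k) = 6 * n := by field_simp; ring
      rw [e] at h5
      linarith)
  refine ⟨Fin n × Bool × Fin k, inferInstance, _,
    fun p r => if (r.1 : ℕ) = p then sg r.2.1 * (2 / Real.sqrt k) else 0, fun _ => 0,
    by convert h2 using 1; ring, ?_, ?_, fun _ _ => rfl⟩
  · intro x p hp
    have hpre : ∀ s s' : Bool,
        (∑ j, sg s' * (1 / 2 * (c (2 * p) j + sg s * c (2 * p + 1) j)) * f x j)
          + sg s' * (1 / 2 * (β (2 * p) + sg s * β (2 * p + 1)))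
        = sg s' * (1 / 2 * (v x (2 * p) + sg s * v x (2 * p + 1))) := by
      intro s s'
      rw [hv x (2 * p) (by omega), hv x (2 * p + 1) (by omega)]
      have : ∀ j, sg s' * (1 / 2 * (c (2 * p) j + sg s * c (2 * p + 1) j)) * f x j
          = sg s' / 2 * (c (2 * p) j * f x j) + sg s' / 2 * sg s * (c (2 * p + 1) j * f x j) := by
        intro j; ring
      simp only [this, Finset.sum_add_distrib, ← Finset.mul_sum]
      ring
    have hin : ∀ s : Bool, (∑ s' : Bool, relu (sg s' * (1 / 2 * (v x (2 * p)
        + sg s * v x (2 * p + 1))))) = |v x (2 * p) + sg s * v x (2 * p + 1)| / 2 := by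
      intro s
      rw [Fintype.sum_bool]
      simp only [sg, if_true, Bool.false_eq_true, if_false]
      rw [relu_add_neg, abs_mul]
      norm_num
      ring
    have houter : ∀ s : Bool, ∀ j : Fin k,
        relu ((∑ r' : Fin n × Bool × Bool,
          (if r'.1 = (⟨p, hp⟩ : Fin n) ∧ r'.2.1 = s then 1 / Real.sqrt k else 0) *
          relu ((∑ j, sg r'.2.2 * (1 / 2 * (c (2 * r'.1) j + sg r'.2.1 * c (2 * r'.1 + 1) j))
              * f x j)
            + sg r'.2.2 * (1 / 2 * (β (2 * r'.1) + sg r'.2.1 * β (2 * r'.1 + 1)))))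
          + - (1 / Real.sqrt k * (((j : ℕ) + 1 / 2) / k)))
        = 1 / Real.sqrt k * relu (|v x (2 * p) + sg s * v x (2 * p + 1)| / 2
            - ((j : ℕ) + 1 / 2) / k) := by
      intro s j
      rw [← relu_mul _ _ (by positivity)]
      congr 1
      rw [mul_sub, ← hin s, ← sub_eq_add_neg]
      congr 1
      rw [Fintype.sum_prod_type, Finset.sum_eq_single (⟨p, hp⟩ : Fin n)]
      · rw [Fintype.sum_prod_type, Finset.sum_eq_single s]
        · simp only [and_self, if_true, hpre, Finset.mul_sum]
        · intro b _ hb; simp [hb]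
        · simp
      · intro b _ hb; simp [hb]
      · simp
    rw [add_zero, Fintype.sum_prod_type, Finset.sum_eq_single (⟨p, hp⟩ : Fin n)]
    · rw [Fintype.sum_prod_type, Fintype.sum_bool]
      simp only [if_true, houter]
      have hc2 : 2 / Real.sqrt k * (1 / Real.sqrt k) = 2 / k := by
        rw [div_mul_div_comm, ← sq, hss, mul_one]
      have hterm : ∀ s : Bool, ∀ t : ℝ, sg s * (2 / Real.sqrt k) * (1 / Real.sqrt k * t)
          = sg s * (2 / k * t) := by
        intro s t; rw [← hc2]; ring
      simp only [hterm, ← Finset.mul_sum]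
      unfold aprod gsq
      simp [sg, sub_eq_add_neg]
    · intro b _ hb
      have : ¬ ((b : ℕ) = p) := fun h => hb (Fin.ext h)
      simp [this]
    · simp
  · intro p
    have hsq : ∀ s : Bool, (sg s * (2 / Real.sqrt k)) ^ 2 = 4 / k := by
      intro s; rw [mul_pow, sg_sq, div_pow, hss]; norm_num
    by_cases hp : p < n
    · rw [Fintype.sum_prod_type, Finset.sum_eq_single (⟨p, hp⟩ : Fin n)]
      · rw [Fintype.sum_prod_type]
        simp only [if_true, hsq]
        simp
        apply le_of_eq
        field_simp
        norm_num
      · intro b _ hb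
        have : ¬ ((b : ℕ) = p) := fun h => hb (Fin.ext h)
        simp [this]
      · simp
    · have : ∀ b : Fin n, ¬ ((b : ℕ) = p) := fun b h => hp (h ▸ b.2)
      simp [this]

lemma tree_lev (d k : ℕ) (hd : 2 ≤ d) (hk : 1 ≤ k) (S : ℕ) (hS : 2 ^ S < d) (t : ℕ)
    (ht : t ≤ S) :
    Lev d (6 * d * k) (2 * (t + 1)) (2 ^ (S - t)) (fun x => tree k (padOne x) (t + 1))
      ((231 * ((2 ^ S : ℕ) : ℝ) ^ 2) ^ (t + 1)) False := by
  have key : ∀ t, 2 ^ (S - t) ≤ 2 ^ S := fun t => Nat.pow_le_pow_right (by norm_num) (by omega)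
  have hw1 : ∀ t, 4 * 2 ^ (S - t) ≤ 6 * d * k := by
    intro t; have := key t; nlinarith
  have hw2 : ∀ t, 2 * k * 2 ^ (S - t) ≤ 6 * d * k := by
    intro t; have := key t; nlinarith
  induction t with
  | zero =>
    have := (Lev.base d (6 * d * k) (2 * 2 ^ (S - 0))).step hk (2 ^ S) Nat.one_le_two_pow
      (key 0) (hw1 0) (hw2 0)
    simpa [tree] using this
  | succ t ih =>
    have h := ih (by omega)
    rw [show 2 ^ (S - t) = 2 * 2 ^ (S - (t + 1)) by
      rw [← pow_succ']; congr 1; omega] at h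
    have := h.step hk (2 ^ S) Nat.one_le_two_pow (key (t + 1)) (hw1 _) (hw2 _)
    rw [← pow_succ] at this
    exact this

/-- **Approximation of `d`-degree monomials.** For every `d ≥ 2` and `k ≥ 1`,
with `s = ⌈log₂ d⌉`, there exists `φ ∈ NN(6dk, 2s, K)` with
`K ≤ 722^s · 2^{(7s² − 7s)/4}` such that `φ : [−1,1]^d → [−1,1]`, `φ(x) = 0` whenever
some coordinate vanishes, and `|x₁⋯x_d − φ(x)| ≤ 6d/k²` on `[−1,1]^d`. -/
theorem monomial_approximation (d k : ℕ) (hd : 2 ≤ d) (hk : 1 ≤ k) :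
    ∃ K : ℝ, K ≤ (722 : ℝ) ^ (Nat.clog 2 d) *
        (2 : ℝ) ^ ((7 * ((Nat.clog 2 d : ℝ)) ^ 2 - 7 * (Nat.clog 2 d : ℝ)) / 4) ∧
      ∃ φ ∈ NNclass d 1 (6 * d * k) (2 * Nat.clog 2 d) K,
        (∀ x ∈ cube d (-1) 1, φ x 0 ∈ Set.Icc (-1 : ℝ) 1) ∧
        (∀ x ∈ cube d (-1) 1, (∃ i, x i = 0) → φ x 0 = 0) ∧
        (∀ x ∈ cube d (-1) 1, |(∏ i, x i) - φ x 0| ≤ 6 * (d : ℝ) / (k : ℝ) ^ 2) := by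
  have hs1 : 1 ≤ Nat.clog 2 d := Nat.clog_pos (by norm_num) hd
  have hlt : 2 ^ (Nat.clog 2 d).pred < d := Nat.pow_pred_clog_lt_self (by norm_num) hd
  have hle : d ≤ 2 ^ Nat.clog 2 d := Nat.le_pow_clog (by norm_num) d
  obtain ⟨S, hS⟩ : ∃ S, Nat.clog 2 d = S + 1 := ⟨Nat.clog 2 d - 1, by omega⟩
  rw [hS] at hlt hle ⊢
  simp only [Nat.pred_succ] at hlt
  have hlev := tree_lev d k hd hk S hlt S le_rfl
  obtain ⟨ι, _, f, c, β, hR, hv, hc, hβ⟩ := hlev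
  have hβ0 := hβ not_false 0
  have hmem := hR.final (c 0) 8 (by have := hc 0; rw [hβ0] at this; simpa using this)
    ((48 : ℝ) ^ (S + 1) * ((2 ^ S : ℕ) : ℝ) ^ (S + 1)) (by positivity) (by
      have h1 : (8 : ℝ) ≤ 8 ^ (S + 1) := le_self_pow₀ (by norm_num) (by omega)
      calc (8 : ℝ) * (231 * ((2 ^ S : ℕ) : ℝ) ^ 2) ^ (S + 1)
          ≤ 8 ^ (S + 1) * (231 * ((2 ^ S : ℕ) : ℝ) ^ 2) ^ (S + 1) := by gcongr
        _ = (8 * 231 * ((2 ^ S : ℕ) : ℝ) ^ 2) ^ (S + 1) := by rw [← mul_pow]; ring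
        _ ≤ (48 ^ 2 * ((2 ^ S : ℕ) : ℝ) ^ 2) ^ (S + 1) := by gcongr; norm_num
        _ = _ := by rw [← mul_pow, ← mul_pow, ← pow_mul, ← pow_mul, mul_comm 2])
  have hφ : ∀ x : Fin d → ℝ, (∑ j, c 0 j * f x j) = tree k (padOne x) (S + 1) 0 := by
    intro x
    have := hv x 0 (by simp)
    rw [hβ0, add_zero] at this
    exact this.symm
  have hX : ∀ x ∈ cube d (-1) 1, ∀ i, |padOne x i| ≤ 1 := by
    intro x hx i
    unfold padOne
    split_ifs with h
    · exact abs_le.2 (hx ⟨i, h⟩)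
    · simp
  refine ⟨_, ?_, _, hmem, ?_, ?_, ?_⟩
  · have e : ((2 ^ S : ℕ) : ℝ) ^ (S + 1) = (2 : ℝ) ^ (((S * (S + 1) : ℕ)) : ℝ) := by
      rw [Real.rpow_natCast]; push_cast; rw [← pow_mul]
    rw [e]
    apply mul_le_mul
    · gcongr; norm_num
    · apply Real.rpow_le_rpow_of_exponent_le (by norm_num)
      push_cast
      have : (0 : ℝ) ≤ S := Nat.cast_nonneg S
      nlinarith
    · positivity
    · positivity
  · intro x hx
    show (∑ j, c 0 j * f x j) ∈ _
    rw [hφ]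
    exact abs_le.1 (tree_abs k hk _ (hX x hx) _ _)
  · rintro x hx ⟨i, hi⟩
    show (∑ j, c 0 j * f x j) = 0
    rw [hφ]
    have := tree_zero k (padOne x) i (by simp [padOne, hi]) (S + 1)
    rwa [Nat.div_eq_of_lt (lt_of_lt_of_le i.2 hle)] at this
  · intro x hx
    show |(∏ i, x i) - (∑ j, c 0 j * f x j)| ≤ _
    rw [hφ]
    have h := tree_err k hk (padOne x) (hX x hx) (S + 1) 0
    have e : (∏ q ∈ range (2 ^ (S + 1)), padOne x (2 ^ (S + 1) * 0 + q)) = ∏ i, x i := by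
      simp only [mul_zero, zero_add]
      rw [← Finset.prod_subset (Finset.range_subset_range.2 hle), ← Fin.prod_univ_eq_prod_range]
      · exact Finset.prod_congr rfl fun i _ => by simp [padOne]
      · intro q _ hq
        simp only [Finset.mem_range] at hq
        simp [padOne, hq]
    rw [e] at h
    refine h.trans ?_
    rw [div_eq_mul_one_div (6 * (d : ℝ))]
    apply mul_le_mul_of_nonneg_right _ (by positivity)
    have : (2 : ℝ) ^ S ≤ d := by exact_mod_cast hlt.le
    rw [pow_succ]
    linarith [Nat.cast_nonneg (α := ℝ) d]
end
end

section
/- Let α = r + β with r ∈ ℕ₀ and β ∈ (0,1], and let h belong to the unit ball of the Hölder space C^α([0,1]^d). Then for all x, x₀ ∈ [0,1]^d, |h(x) − ∑_{|s| ≤ r} (∂^s h(x₀)/s!) (x − x₀)^s| ≤ d^r ‖x − x₀‖_∞^α, where the sum ranges over multi-indices s ∈ ℕ₀^d with |s| = s_1 + ⋯ + s_d ≤ r. -/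
open scoped BigOperators Classical

noncomputable section

/-- Partial derivative in the `i`-th coordinate direction. -/
def pd {n : ℕ} (i : Fin n) (h : (Fin n → ℝ) → ℝ) : (Fin n → ℝ) → ℝ :=
  fun x => fderiv ℝ h x (Pi.single i 1)

/-- Multi-index partial derivative `D^s h = ∂_1^{s 1} ⋯ ∂_n^{s n} h`. -/
def mderiv {n : ℕ} (s : Fin n → ℕ) (h : (Fin n → ℝ) → ℝ) : (Fin n → ℝ) → ℝ :=
  Fin.foldr n (fun i f => (pd i)^[s i] f) h

/-- The multi-indices `s` with `|s| ≤ r`, encoded as functions `Fin n → Fin (r+1)`. -/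
def multiIdxLe (n r : ℕ) : Finset (Fin n → Fin (r + 1)) :=
  Finset.univ.filter fun s => (∑ i, (s i : ℕ)) ≤ r

/-- Membership in the unit ball of the Hölder space `C^{r+β}(S)`:
`h` is `r` times continuously differentiable and
`∑_{|γ|≤r} ‖D^γ h‖_{L^∞(S)} + max_{|γ|=r} sup_{x≠y∈S} |D^γ h(x) − D^γ h(y)|/‖x−y‖_∞^β ≤ 1`,
expressed through bounds `M γ` on the derivatives and `C` on the Hölder seminorms. -/
def HolderUnitBall {n : ℕ} (r : ℕ) (β : ℝ) (S : Set (Fin n → ℝ))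
    (h : (Fin n → ℝ) → ℝ) : Prop :=
  ContDiff ℝ r h ∧
  ∃ (M : (Fin n → Fin (r + 1)) → ℝ) (C : ℝ),
    (∀ s ∈ multiIdxLe n r, ∀ x ∈ S, |mderiv (fun i => (s i : ℕ)) h x| ≤ M s) ∧
    (∀ s : Fin n → Fin (r + 1), (∑ i, (s i : ℕ)) = r → ∀ x ∈ S, ∀ y ∈ S,
      |mderiv (fun i => (s i : ℕ)) h x - mderiv (fun i => (s i : ℕ)) h y|
        ≤ C * ‖x - y‖ ^ β) ∧
    (∑ s ∈ multiIdxLe n r, M s) + C ≤ 1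

/-! ### Partial derivatives: smoothness and commutation -/

lemma pd_contDiff {n k : ℕ} (i : Fin n) {f : (Fin n → ℝ) → ℝ}
    (hf : ContDiff ℝ ((k + 1 : ℕ) : WithTop ℕ∞) f) : ContDiff ℝ (k : WithTop ℕ∞) (pd i f) := by
  unfold pd
  exact (hf.fderiv_right (m := (k : WithTop ℕ∞)) (by norm_cast)).clm_apply contDiff_const

lemma pd_comm {n : ℕ} (i j : Fin n) {f : (Fin n → ℝ) → ℝ}
    (hf : ContDiff ℝ ((2 : ℕ) : WithTop ℕ∞) f) : pd i (pd j f) = pd j (pd i f) := by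
  have hd : Differentiable ℝ (fderiv ℝ f) :=
    (hf.fderiv_right (m := ((1 : ℕ) : WithTop ℕ∞)) (by norm_cast)).differentiable (by norm_num)
  funext x
  have key : ∀ a b : Fin n, pd a (pd b f) x
      = fderiv ℝ (fderiv ℝ f) x (Pi.single a 1) (Pi.single b 1) := by
    intro a b
    unfold pd
    rw [fderiv_clm_apply (hd x) (differentiableAt_const _)]
    simp
  rw [key, key]
  have hs : IsSymmSndFDerivAt ℝ f x :=
    hf.contDiffAt.isSymmSndFDerivAt (by simp [minSmoothness_of_isRCLikeNormedField])
  exact hs.eq _ _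

lemma pd_iter_contDiff {n : ℕ} (i : Fin n) (m : ℕ) : ∀ {k : ℕ} {f : (Fin n → ℝ) → ℝ},
    ContDiff ℝ ((m + k : ℕ) : WithTop ℕ∞) f → ContDiff ℝ (k : WithTop ℕ∞) ((pd i)^[m] f) := by
  induction m with
  | zero => intro k f hf; simpa using hf
  | succ m ih =>
    intro k f hf
    rw [Function.iterate_succ_apply]
    apply ih
    apply pd_contDiff
    exact hf.of_le (by norm_cast; omega)

lemma pd_iter_comm {n : ℕ} (i a : Fin n) (m : ℕ) : ∀ {f : (Fin n → ℝ) → ℝ},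
    ContDiff ℝ ((m + 1 : ℕ) : WithTop ℕ∞) f →
      pd i ((pd a)^[m] f) = (pd a)^[m] (pd i f) := by
  induction m with
  | zero => intro f _; rfl
  | succ m ih =>
    intro f hf
    rw [Function.iterate_succ_apply, Function.iterate_succ_apply, ih (pd_contDiff a hf),
      pd_comm i a (hf.of_le (by norm_cast; omega))]

/-- Iterated derivatives along a list of directions. -/
def lderiv {n : ℕ} (l : List (Fin n)) (s : Fin n → ℕ) (h : (Fin n → ℝ) → ℝ) :
    (Fin n → ℝ) → ℝ :=
  l.foldr (fun i f => (pd i)^[s i] f) h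

lemma lderiv_cons {n : ℕ} (a : Fin n) (l : List (Fin n)) (s : Fin n → ℕ)
    (h : (Fin n → ℝ) → ℝ) : lderiv (a :: l) s h = (pd a)^[s a] (lderiv l s h) := rfl

lemma mderiv_eq_lderiv {n : ℕ} (s : Fin n → ℕ) (h : (Fin n → ℝ) → ℝ) :
    mderiv s h = lderiv (List.finRange n) s h := by
  unfold mderiv lderiv
  rw [Fin.foldr_eq_foldr_finRange]

lemma lderiv_contDiff {n : ℕ} (s : Fin n → ℕ) (l : List (Fin n)) :
    ∀ {k : ℕ} {h : (Fin n → ℝ) → ℝ},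
    ContDiff ℝ (((l.map s).sum + k : ℕ) : WithTop ℕ∞) h →
      ContDiff ℝ (k : WithTop ℕ∞) (lderiv l s h) := by
  induction l with
  | nil => intro k h hh; simpa [lderiv] using hh
  | cons a l ih =>
    intro k h hh
    rw [lderiv_cons]
    apply pd_iter_contDiff
    apply ih
    simp only [List.map_cons, List.sum_cons] at hh
    exact hh.of_le (by norm_cast; omega)

lemma pd_lderiv {n : ℕ} (i : Fin n) (s : Fin n → ℕ) (l : List (Fin n)) :
    ∀ {h : (Fin n → ℝ) → ℝ},
    ContDiff ℝ (((l.map s).sum + 1 : ℕ) : WithTop ℕ∞) h →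
      pd i (lderiv l s h) = lderiv l s (pd i h) := by
  induction l with
  | nil => intro h _; rfl
  | cons a l ih =>
    intro h hh
    simp only [List.map_cons, List.sum_cons] at hh
    rw [lderiv_cons, lderiv_cons, pd_iter_comm, ih]
    · exact hh.of_le (by norm_cast; omega)
    · apply lderiv_contDiff
      exact hh.of_le (by norm_cast; omega)

lemma lderiv_add_notMem {n : ℕ} (i : Fin n) (s : Fin n → ℕ) (l : List (Fin n)) (hi : i ∉ l)
    (h : (Fin n → ℝ) → ℝ) : lderiv l (s + Pi.single i 1) h = lderiv l s h := by
  induction l with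
  | nil => rfl
  | cons a l ih =>
    simp only [List.mem_cons, not_or] at hi
    rw [lderiv_cons, lderiv_cons, ih hi.2]
    simp [Pi.single_apply, Ne.symm hi.1]

lemma lderiv_add_mem {n : ℕ} (i : Fin n) (s : Fin n → ℕ) (l : List (Fin n)) (hl : l.Nodup)
    (hi : i ∈ l) {h : (Fin n → ℝ) → ℝ}
    (hh : ContDiff ℝ (((l.map s).sum + 1 : ℕ) : WithTop ℕ∞) h) :
    lderiv l (s + Pi.single i 1) h = lderiv l s (pd i h) := by
  induction l with
  | nil => simp at hi
  | cons a l ih =>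
    simp only [List.map_cons, List.sum_cons] at hh
    have hh' : ContDiff ℝ (((l.map s).sum + 1 : ℕ) : WithTop ℕ∞) h :=
      hh.of_le (by norm_cast; omega)
    rw [List.nodup_cons] at hl
    rw [lderiv_cons, lderiv_cons]
    by_cases hai : a = i
    · subst hai
      rw [lderiv_add_notMem _ _ _ hl.1, ← pd_lderiv a s l hh', ← Function.iterate_succ_apply]
      simp
    · have him : i ∈ l := by
        rcases List.mem_cons.1 hi with h1 | h1
        · exact absurd h1.symm hai
        · exact h1
      rw [ih hl.2 him hh']
      simp [Pi.single_apply, hai]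

lemma mderiv_add {n : ℕ} (i : Fin n) (s : Fin n → ℕ) {h : (Fin n → ℝ) → ℝ}
    (hh : ContDiff ℝ (((∑ j, s j) + 1 : ℕ) : WithTop ℕ∞) h) :
    mderiv (s + Pi.single i 1) h = mderiv s (pd i h) := by
  rw [mderiv_eq_lderiv, mderiv_eq_lderiv]
  apply lderiv_add_mem _ _ _ (List.nodup_finRange n) (List.mem_finRange i)
  convert hh using 4
  rw [Fin.sum_univ_def]

lemma mderiv_zero {n : ℕ} (h : (Fin n → ℝ) → ℝ) : mderiv (0 : Fin n → ℕ) h = h := by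
  rw [mderiv_eq_lderiv]
  induction List.finRange n with
  | nil => rfl
  | cons a l ih => rw [lderiv_cons, ih]; rfl

/-! ### Natural-number-valued multi-indices -/

/-- Multi-indices of order at most `r`. -/
def idx (n r : ℕ) : Finset (Fin n → ℕ) :=
  (Fintype.piFinset fun _ : Fin n => Finset.range (r + 1)).filter fun s => ∑ i, s i ≤ r

lemma mem_idx {n r : ℕ} {s : Fin n → ℕ} : s ∈ idx n r ↔ ∑ i, s i ≤ r := by
  unfold idx
  simp only [Finset.mem_filter, Fintype.mem_piFinset, Finset.mem_range, and_iff_right_iff_imp]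
  intro hs i
  have := Finset.single_le_sum (f := s) (fun j _ => Nat.zero_le _) (Finset.mem_univ i)
  omega

lemma sum_multiIdxLe {n r : ℕ} (F : (Fin n → ℕ) → ℝ) :
    ∑ s ∈ multiIdxLe n r, F (fun i => (s i : ℕ)) = ∑ s ∈ idx n r, F s := by
  refine Finset.sum_bij (fun s _ => fun i => (s i : ℕ)) ?_ ?_ ?_ ?_
  · intro s hs
    rw [mem_idx]
    simpa [multiIdxLe] using hs
  · intro s _ t _ hst
    funext i
    exact Fin.ext (congrFun hst i)
  · intro s hs
    rw [mem_idx] at hs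
    have hlt : ∀ i, s i < r + 1 := by
      intro i
      have := Finset.single_le_sum (f := s) (fun j _ => Nat.zero_le _) (Finset.mem_univ i)
      omega
    exact ⟨fun i => ⟨s i, hlt i⟩, by simpa [multiIdxLe] using hs, rfl⟩
  · intro s _
    rfl

/-- The coefficient `v^s / s!`. -/
def mono {n : ℕ} (v : Fin n → ℝ) (s : Fin n → ℕ) : ℝ :=
  ∏ i, (v i ^ s i / (Nat.factorial (s i) : ℝ))

lemma mono_smul {n : ℕ} (t : ℝ) (v : Fin n → ℝ) (s : Fin n → ℕ) :
    mono (t • v) s = t ^ (∑ i, s i) * mono v s := by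
  unfold mono
  rw [← Finset.prod_pow_eq_pow_sum, ← Finset.prod_mul_distrib]
  refine Finset.prod_congr rfl fun i _ => ?_
  simp only [Pi.smul_apply, smul_eq_mul, mul_pow]
  ring

lemma mono_add {n : ℕ} (v : Fin n → ℝ) (s : Fin n → ℕ) (i : Fin n) :
    ((s i + 1 : ℕ) : ℝ) * mono v (s + Pi.single i 1) = v i * mono v s := by
  unfold mono
  rw [Fintype.prod_eq_mul_prod_compl i, Fintype.prod_eq_mul_prod_compl i]
  have : ∏ j ∈ ({i} : Finset (Fin n))ᶜ, (v j ^ (s + Pi.single i 1 : Fin n → ℕ) j /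
      (Nat.factorial ((s + Pi.single i 1 : Fin n → ℕ) j) : ℝ))
      = ∏ j ∈ ({i} : Finset (Fin n))ᶜ, (v j ^ s j / (Nat.factorial (s j) : ℝ)) := by
    refine Finset.prod_congr rfl fun j hj => ?_
    have hj' : j ≠ i := by simpa using hj
    simp [Pi.single_apply, hj']
  rw [this]
  have h1 : (s + Pi.single i 1 : Fin n → ℕ) i = s i + 1 := by simp
  rw [h1, Nat.factorial_succ, pow_succ]
  have h2 : (Nat.factorial (s i) : ℝ) ≠ 0 := by positivity
  have h3 : ((s i + 1 : ℕ) : ℝ) ≠ 0 := by positivity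
  rw [Nat.cast_mul]
  field_simp

/-- Taylor polynomial. -/
def tay {n : ℕ} (r : ℕ) (h : (Fin n → ℝ) → ℝ) (x₀ v : Fin n → ℝ) : ℝ :=
  ∑ s ∈ idx n r, mderiv s h x₀ * mono v s

lemma sum_shift {n r : ℕ} (i : Fin n) (F : (Fin n → ℕ) → ℝ) (hF : ∀ s, s i = 0 → F s = 0) :
    ∑ s ∈ idx n (r + 1), F s = ∑ s ∈ idx n r, F (s + Pi.single i 1) := by
  symm
  refine Finset.sum_of_injOn (fun s => s + Pi.single i 1) ?_ ?_ ?_ ?_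
  · intro s _ t _ hst
    exact add_right_cancel hst
  · intro s hs
    simp only [Finset.mem_coe, mem_idx] at hs ⊢
    simpa [Finset.sum_add_distrib] using hs
  · intro s hs hns
    apply hF
    by_contra h0
    apply hns
    have hle : Pi.single i 1 ≤ s := by
      intro j
      by_cases hj : j = i
      · subst hj; simp; omega
      · simp [Pi.single_apply, hj]
    have hsum : s - Pi.single i 1 + Pi.single i 1 = s := tsub_add_cancel_of_le hle
    refine ⟨s - Pi.single i 1, ?_, hsum⟩
    simp only [Finset.mem_coe, mem_idx] at hs ⊢
    rw [← hsum] at hs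
    simpa only [Pi.add_apply, Finset.sum_add_distrib, Finset.sum_pi_single', Finset.sum_pi_single,
      Finset.mem_univ, if_true, Nat.add_le_add_iff_right] using hs
  · intro s _
    rfl

lemma tay_hasDerivAt {n r : ℕ} {h : (Fin n → ℝ) → ℝ}
    (hh : ContDiff ℝ ((r + 1 : ℕ) : WithTop ℕ∞) h) (x₀ v : Fin n → ℝ) (t : ℝ) :
    HasDerivAt (fun t : ℝ => tay (r + 1) h x₀ (t • v))
      (∑ i, v i * tay r (pd i h) x₀ (t • v)) t := by
  have h1 : HasDerivAt (fun t : ℝ => tay (r + 1) h x₀ (t • v))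
      (∑ s ∈ idx n (r + 1), mderiv s h x₀ *
        ((((∑ i, s i : ℕ) : ℝ) * t ^ ((∑ i, s i) - 1)) * mono v s)) t := by
    unfold tay
    simp only [mono_smul]
    refine HasDerivAt.fun_sum fun s _ => ?_
    exact ((hasDerivAt_pow _ t).mul_const _).const_mul _
  convert h1 using 1
  have h2 : ∀ s ∈ idx n (r + 1), mderiv s h x₀ *
        ((((∑ i, s i : ℕ) : ℝ) * t ^ ((∑ i, s i) - 1)) * mono v s)
      = ∑ i, (s i : ℝ) * (mderiv s h x₀ * t ^ ((∑ i, s i) - 1) * mono v s) := by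
    intro s _
    rw [← Finset.sum_mul]
    push_cast
    ring
  rw [Finset.sum_congr rfl h2, Finset.sum_comm]
  refine Finset.sum_congr rfl fun i _ => ?_
  rw [sum_shift i _ (by intro s hs; simp [hs])]
  unfold tay
  rw [Finset.mul_sum]
  refine Finset.sum_congr rfl fun s hs => ?_
  rw [mem_idx] at hs
  rw [mderiv_add i s (hh.of_le (by norm_cast; omega)), mono_smul]
  have h3 : (∑ j, (s + Pi.single i 1 : Fin n → ℕ) j) - 1 = ∑ j, s j := by
    simp [Finset.sum_add_distrib]
  have h4 : (s + Pi.single i 1 : Fin n → ℕ) i = s i + 1 := by simp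
  rw [h3, h4]
  linear_combination (-(mderiv s (pd i h) x₀ * t ^ (∑ j, s j))) * mono_add v s i

lemma fderiv_eq_sum_pd {n : ℕ} (h : (Fin n → ℝ) → ℝ) (x v : Fin n → ℝ) :
    fderiv ℝ h x v = ∑ i, v i * pd i h x := by
  conv_lhs => rw [pi_eq_sum_univ' v]
  simp [pd, map_sum]

lemma tay_zero_right {n r : ℕ} (h : (Fin n → ℝ) → ℝ) (x₀ : Fin n → ℝ) :
    tay r h x₀ 0 = h x₀ := by
  unfold tay
  rw [Finset.sum_eq_single (0 : Fin n → ℕ)]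
  · simp [mderiv_zero, mono]
  · intro s _ hs
    obtain ⟨i, hi⟩ := Function.ne_iff.1 hs
    have : mono (0 : Fin n → ℝ) s = 0 := by
      unfold mono
      refine Finset.prod_eq_zero (Finset.mem_univ i) ?_
      simp only [Pi.zero_apply] at hi ⊢
      simp [hi]
    simp [this]
  · intro h0
    exact absurd (mem_idx.2 (by simp)) h0

lemma remainder_bound {n : ℕ} {β C : ℝ} (hβ : 0 < β) (hC : 0 ≤ C) {S : Set (Fin n → ℝ)}
    (hS : Convex ℝ S) (r : ℕ) : ∀ h : (Fin n → ℝ) → ℝ, ContDiff ℝ (r : WithTop ℕ∞) h →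
    (∀ s : Fin n → ℕ, ∑ i, s i = r → ∀ x ∈ S, ∀ y ∈ S,
      |mderiv s h x - mderiv s h y| ≤ C * ‖x - y‖ ^ β) →
    ∀ x₀ ∈ S, ∀ v, x₀ + v ∈ S →
      |h (x₀ + v) - tay r h x₀ v| ≤ C * (n : ℝ) ^ r * ‖v‖ ^ ((r : ℝ) + β) := by
  induction r with
  | zero =>
    intro h hh hol x₀ hx₀ v hv
    have := hol 0 (by simp) _ hv _ hx₀
    rw [mderiv_zero] at this
    have ht : tay 0 h x₀ v = h x₀ := by
      unfold tay
      have : idx n 0 = {0} := by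
        ext s
        rw [mem_idx]
        simp [funext_iff]
      rw [this]
      simp [mderiv_zero, mono]
    rw [ht]
    simpa using this
  | succ r ih =>
    intro h hh hol x₀ hx₀ v hv
    have hseg : ∀ t ∈ Set.Icc (0 : ℝ) 1, x₀ + t • v ∈ S := by
      intro t ht
      exact hS.add_smul_mem hx₀ hv ht
    have hdh : Differentiable ℝ h := hh.differentiable (by norm_num)
    have hder : ∀ t : ℝ, HasDerivAt (fun t : ℝ => h (x₀ + t • v) - tay (r + 1) h x₀ (t • v))
        (∑ i, v i * (pd i h (x₀ + t • v) - tay r (pd i h) x₀ (t • v))) t := by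
      intro t
      have h1 : HasDerivAt (fun t : ℝ => x₀ + t • v) v t := by
        simpa using ((hasDerivAt_id t).smul_const v).const_add x₀
      have h2 := (hdh (x₀ + t • v)).hasFDerivAt.comp_hasDerivAt t h1
      rw [fderiv_eq_sum_pd] at h2
      have h3 := h2.sub (tay_hasDerivAt hh x₀ v t)
      have h4 : ∑ i, v i * (pd i h (x₀ + t • v) - tay r (pd i h) x₀ (t • v))
          = ∑ i, v i * pd i h (x₀ + t • v) - ∑ i, v i * tay r (pd i h) x₀ (t • v) := by
        rw [← Finset.sum_sub_distrib]
        exact Finset.sum_congr rfl fun i _ => by ring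
      rw [h4]
      exact h3
    have hbound : ∀ t ∈ Set.Icc (0 : ℝ) 1,
        ‖∑ i, v i * (pd i h (x₀ + t • v) - tay r (pd i h) x₀ (t • v))‖
          ≤ C * (n : ℝ) ^ (r + 1) * ‖v‖ ^ (((r + 1 : ℕ) : ℝ) + β) := by
      intro t ht
      have hi : ∀ i ∈ (Finset.univ : Finset (Fin n)),
          ‖v i * (pd i h (x₀ + t • v) - tay r (pd i h) x₀ (t • v))‖
          ≤ ‖v‖ * (C * (n : ℝ) ^ r * ‖v‖ ^ ((r : ℝ) + β)) := by
        intro i _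
        rw [norm_mul]
        refine mul_le_mul (norm_le_pi_norm v i) ?_ (norm_nonneg _) (norm_nonneg _)
        rw [Real.norm_eq_abs]
        refine (ih (pd i h) (pd_contDiff i hh) ?_ x₀ hx₀ (t • v) (hseg t ht)).trans ?_
        · intro s hs x hx y hy
          rw [← mderiv_add i s (by rw [hs]; exact hh)]
          refine hol _ ?_ x hx y hy
          simp [Finset.sum_add_distrib, hs]
        · have : ‖t • v‖ ≤ ‖v‖ := by
            rw [norm_smul, Real.norm_eq_abs, abs_of_nonneg ht.1]
            exact mul_le_of_le_one_left (norm_nonneg _) ht.2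
          gcongr
      refine (norm_sum_le_of_le _ hi).trans (le_of_eq ?_)
      rw [Finset.sum_const, Finset.card_univ, Fintype.card_fin, nsmul_eq_mul]
      have hp : ‖v‖ ^ (((r + 1 : ℕ) : ℝ) + β) = ‖v‖ * ‖v‖ ^ ((r : ℝ) + β) := by
        have hne : (r : ℝ) + β + 1 ≠ 0 := by positivity
        have := Real.rpow_add_one' (norm_nonneg v) hne
        rw [mul_comm, ← this]
        congr 1
        push_cast
        ring
      rw [hp]
      ring
    have := norm_image_sub_le_of_norm_deriv_le_segment_01'
      (fun t _ => (hder t).hasDerivWithinAt) (fun t ht => hbound t ⟨ht.1, ht.2.le⟩)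
    simpa [tay_zero_right] using this

/-- **Taylor remainder for Hölder functions.** If `h` is in the unit ball of
`C^{r+β}([0,1]^d)`, then for all `x, x₀ ∈ [0,1]^d`,
`|h(x) − ∑_{|s|≤r} (∂^s h(x₀)/s!) (x−x₀)^s| ≤ d^r ‖x−x₀‖_∞^{r+β}`. -/
theorem taylor_remainder_holder (d r : ℕ) (hd : 1 ≤ d) (β : ℝ) (hβ : β ∈ Set.Ioc (0 : ℝ) 1)
    (h : (Fin d → ℝ) → ℝ) (hh : HolderUnitBall r β (cube d 0 1) h) :
    ∀ x ∈ cube d 0 1, ∀ x₀ ∈ cube d 0 1,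
      |h x - ∑ s ∈ multiIdxLe d r,
          (mderiv (fun i => (s i : ℕ)) h x₀ / ∏ i, (Nat.factorial (s i) : ℝ)) *
            ∏ i, (x i - x₀ i) ^ (s i : ℕ)|
        ≤ (d : ℝ) ^ r * ‖x - x₀‖ ^ ((r : ℝ) + β) := by
  intro x hx x₀ hx₀
  obtain ⟨hcd, M, C, hM, hol, hsum⟩ := hh
  have hol' : ∀ s : Fin d → ℕ, ∑ i, s i = r → ∀ x ∈ cube d 0 1, ∀ y ∈ cube d 0 1,
      |mderiv s h x - mderiv s h y| ≤ C * ‖x - y‖ ^ β := by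
    intro s hs
    have hlt : ∀ i, s i < r + 1 := by
      intro i
      have := Finset.single_le_sum (f := s) (fun j _ => Nat.zero_le _) (Finset.mem_univ i)
      omega
    exact hol (fun i => ⟨s i, hlt i⟩) hs
  have hC0 : 0 ≤ C := by
    have i0 : Fin d := ⟨0, hd⟩
    have hs : ∑ i, (Pi.single i0 r : Fin d → ℕ) i = r := by simp
    have h1 := hol' _ hs (fun _ => 1) (by intro i; simp) (fun _ => 0) (by intro i; simp)
    have h2 : ‖(fun _ => 1 : Fin d → ℝ) - (fun _ => 0)‖ = 1 := by
      have : Nonempty (Fin d) := ⟨i0⟩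
      have : (fun _ => 1 : Fin d → ℝ) - (fun _ => 0) = fun _ => (1 : ℝ) := by
        funext i; simp
      rw [this, pi_norm_const]
      simp
    rw [h2] at h1
    have := (abs_nonneg _).trans h1
    simpa using this
  have hC1 : C ≤ 1 := by
    have : 0 ≤ ∑ s ∈ multiIdxLe d r, M s :=
      Finset.sum_nonneg fun s hs => (abs_nonneg _).trans (hM s hs x hx)
    linarith
  have hconv : Convex ℝ (cube d 0 1) := by
    have : cube d 0 1 = Set.pi Set.univ fun _ => Set.Icc (0 : ℝ) 1 := by
      ext y; simp only [cube, Set.mem_setOf_eq, Set.mem_pi, Set.mem_univ, true_imp_iff]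
    rw [this]
    exact convex_pi fun i _ => convex_Icc 0 1
  have key := remainder_bound hβ.1 hC0 hconv r h hcd hol' x₀ hx₀ (x - x₀) (by simpa using hx)
  rw [add_sub_cancel] at key
  have ht : ∑ s ∈ multiIdxLe d r,
          (mderiv (fun i => (s i : ℕ)) h x₀ / ∏ i, (Nat.factorial (s i) : ℝ)) *
            ∏ i, (x i - x₀ i) ^ (s i : ℕ) = tay r h x₀ (x - x₀) := by
    unfold tay
    rw [← sum_multiIdxLe (fun s => mderiv s h x₀ * mono (x - x₀) s)]
    refine Finset.sum_congr rfl fun s _ => ?_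
    simp only [mono, Pi.sub_apply, Finset.prod_div_distrib]
    ring
  rw [ht]
  refine key.trans ?_
  have : 0 ≤ (d : ℝ) ^ r * ‖x - x₀‖ ^ ((r : ℝ) + β) := by positivity
  nlinarith
end
end
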